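/- Let p ∈ ℝ[x] be a real polynomial with deg p ≤ L, parity L mod 2, and |p(x)| ≤ 1 for all x ∈ [−1,1]. Then there exists θ ∈ ℝ^{L+1} such that ⟨+| U_θ(x) |+⟩ = p(x) for all x ∈ [−1,1], where U_θ(x) = R_Z(θ₀) Π_{j=1}^L S(x) R_Z(θ_j), S(x) = [[x, i√(1−x²)],[i√(1−x²), x]], R_Z(θ) = diag(e^{−iθ/2}, e^{iθ/2}), and |+⟩ = (1,1)^T/√2. -/

import Mathlib

open Complex

/-- The Pauli-`Z` rotation `R_Z(θ) = diag(e^{−iθ/2}, e^{iθ/2})`. -/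
noncomputable def RZgate (θ : ℝ) : Matrix (Fin 2) (Fin 2) ℂ :=
  !![Complex.exp (-Complex.I * θ / 2), 0; 0, Complex.exp (Complex.I * θ / 2)]

/-- The data-encoding gate `S(x) = exp(i·arccos(x)·X)`. -/
noncomputable def Sgate (x : ℝ) : Matrix (Fin 2) (Fin 2) ℂ :=
  !![(x : ℂ), Complex.I * Real.sqrt (1 - x ^ 2);
     Complex.I * Real.sqrt (1 - x ^ 2), (x : ℂ)]

/-- The `L`-layer single-qubit PQC `U_θ(x) = R_Z(θ₀) Π_{j=1}^L S(x) R_Z(θ_j)`. -/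
noncomputable def Upqc (L : ℕ) (θ : Fin (L + 1) → ℝ) (x : ℝ) : Matrix (Fin 2) (Fin 2) ℂ :=
  RZgate (θ 0) * (List.ofFn fun j : Fin L => Sgate x * RZgate (θ j.succ)).prod

/-- `⟨+|M|+⟩`, where `|+⟩ = (1,1)ᵀ/√2`. -/
noncomputable def plusForm (M : Matrix (Fin 2) (Fin 2) ℂ) : ℂ :=
  (M 0 0 + M 0 1 + M 1 0 + M 1 1) / 2

open Polynomial in
/-- degree at most `L` and parity `L mod 2`. -/
def QHom {R : Type*} [CommRing R] (L : ℕ) (f : R[X]) : Prop :=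
  ∀ k, (L < k ∨ k % 2 ≠ L % 2) → f.coeff k = 0

namespace QHom
open Polynomial
variable {R : Type*} [CommRing R] {L M : ℕ} {f g : R[X]}

lemma add (hf : QHom L f) (hg : QHom L g) : QHom L (f + g) := by
  intro k hk; simp [hf k hk, hg k hk]

lemma sub (hf : QHom L f) (hg : QHom L g) : QHom L (f - g) := by
  intro k hk; simp [hf k hk, hg k hk]

lemma mul (hf : QHom L f) (hg : QHom M g) : QHom (L + M) (f * g) := by
  intro k hk
  rw [coeff_mul]
  refine Finset.sum_eq_zero ?_
  rintro ⟨i, j⟩ hij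
  rw [Finset.HasAntidiagonal.mem_antidiagonal] at hij
  simp only at hij ⊢
  by_cases h : L < i ∨ i % 2 ≠ L % 2
  · simp [hf i h]
  · have : M < j ∨ j % 2 ≠ M % 2 := by omega
    simp [hg j this]

lemma const (a : R) : QHom 0 (C a) := by
  intro k hk
  rw [coeff_C, if_neg (by omega)]

lemma C_mul (a : R) (hf : QHom L f) : QHom L (C a * f) := by
  intro k hk; simp [hf k hk]

lemma X_ : QHom 1 (X : R[X]) := by
  intro k hk
  rw [coeff_X, if_neg (by omega)]

lemma X_mul (hf : QHom L f) : QHom (L + 1) (X * f) := by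
  rw [add_comm]; exact X_.mul hf

lemma of_X_mul (hf : QHom (L + 1) (X * f)) : QHom L f := by
  intro k hk
  have := hf (k + 1) (by omega)
  rwa [coeff_X_mul] at this

lemma up (hf : QHom L f) : QHom (L + 2) f := by
  intro k hk
  exact hf k (by omega)

lemma down (hf : QHom (L + 2) f) (h : f.coeff (L + 2) = 0) : QHom L f := by
  intro k hk
  by_cases h1 : k = L + 2
  · rwa [h1]
  · exact hf k (by omega)

lemma natDegree_le (hf : QHom L f) : f.natDegree ≤ L := by
  rw [natDegree_le_iff_coeff_eq_zero]
  intro k hk; exact hf k (Or.inl hk)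

lemma map {S : Type*} [CommRing S] (φ : R →+* S) (hf : QHom L f) : QHom L (f.map φ) := by
  intro k hk; simp [hf k hk]
end QHom

section Rep
open Polynomial

/-- sum of squares representation -/
def QRep (L : ℕ) (G : ℝ[X]) : Prop :=
  ∃ b c : ℝ[X], QHom L b ∧ QHom L (X * c) ∧ expand ℝ 2 G = b ^ 2 + (1 - X ^ 2) * c ^ 2

lemma QRep.mul {L M : ℕ} {G H : ℝ[X]} (hG : QRep L G) (hH : QRep M H) : QRep (L + M) (G * H) := by
  obtain ⟨b, c, hb, hc, h⟩ := hG
  obtain ⟨b', c', hb', hc', h'⟩ := hH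
  refine ⟨b * b' - c * c' + (X * c) * (X * c'), b * c' + b' * c, ?_, ?_, ?_⟩
  · have h1 : QHom (L + M) ((X * c) * (X * c')) := hc.mul hc'
    refine ((hb.mul hb').sub ?_).add h1
    have h2 := h1.up
    have h3 : (X * c) * (X * c') = X * (X * (c * c')) := by ring
    rw [h3] at h2
    exact h2.of_X_mul.of_X_mul
  · have : X * (b * c' + b' * c) = b * (X * c') + (X * c) * b' := by ring
    rw [this]
    exact (hb.mul hc').add (hc.mul hb')
  · rw [map_mul, h, h']; ring

lemma QRep.const {a : ℝ} (ha : 0 ≤ a) : QRep 0 (C a) := by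
  refine ⟨C (√a), 0, QHom.const _, ?_, ?_⟩
  · intro k _; simp
  · rw [expand_C, ← C_pow, Real.sq_sqrt ha]; simp

lemma QRep.linear {a d : ℝ} (ha : 0 ≤ a) (had : 0 ≤ a + d) : QRep 1 (C a + C d * X) := by
  refine ⟨C (√(a + d)) * X, C (√a), QHom.X_.C_mul _, ?_, ?_⟩
  · exact (QHom.const _).X_mul
  · rw [mul_pow, ← C_pow, ← C_pow, Real.sq_sqrt ha, Real.sq_sqrt had]
    simp; ring

lemma QRep.one_one : QRep 1 1 := by
  have := @QRep.linear 1 0 (by norm_num) (by norm_num)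
  simpa using this

lemma QRep.quad (u v : ℝ) : QRep 2 ((X - C u) ^ 2 + C (v ^ 2)) := by
  obtain ⟨m, hm, hm2⟩ : ∃ m : ℝ, 0 ≤ m ∧ m ^ 2 = u ^ 2 + v ^ 2 :=
    ⟨√(u ^ 2 + v ^ 2), Real.sqrt_nonneg _, Real.sq_sqrt (by positivity)⟩
  obtain ⟨n, hn, hn2⟩ : ∃ n : ℝ, 0 ≤ n ∧ n ^ 2 = (1 - u) ^ 2 + v ^ 2 :=
    ⟨√((1 - u) ^ 2 + v ^ 2), Real.sqrt_nonneg _, Real.sq_sqrt (by positivity)⟩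
  have h1 : |u| ≤ m := abs_le_of_sq_le_sq (by nlinarith [sq_nonneg v]) hm
  have h2 : |1 - u| ≤ n := abs_le_of_sq_le_sq (by nlinarith [sq_nonneg v]) hn
  have h3 : 1 ≤ m + n := by
    have := le_abs_self u; have := le_abs_self (1 - u); linarith
  obtain ⟨g, hg⟩ : ∃ g : ℝ, g ^ 2 = (m + n) ^ 2 - 1 :=
    ⟨√((m + n) ^ 2 - 1), Real.sq_sqrt (by nlinarith)⟩
  refine ⟨C (m + n) * X ^ 2 - C m, C g * X, ?_, ?_, ?_⟩
  · rw [sq]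
    exact ((QHom.X_mul QHom.X_).C_mul _).sub (QHom.const m).up
  · exact (QHom.X_.C_mul g).X_mul
  · have e1 : (C m : ℝ[X]) ^ 2 = C u ^ 2 + C v ^ 2 := by
      rw [← C_pow, hm2]; simp
    have e2 : (C n : ℝ[X]) ^ 2 = (1 - C u) ^ 2 + C v ^ 2 := by
      rw [← C_pow, hn2]; simp
    have e3 : (C g : ℝ[X]) ^ 2 = (C m + C n) ^ 2 - 1 := by
      rw [← C_pow, hg]; simp
    simp only [map_add, map_sub, map_pow, expand_X, expand_C]
    linear_combination (X ^ 2 - 1) * e1 - X ^ 2 * e2 - X ^ 2 * (1 - X ^ 2) * e3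

lemma nonneg_of_off {H : ℝ[X]} (r : ℝ) (a b : ℝ) (hab : a < b)
    (h : ∀ y ∈ Set.Ioo a b, y ≠ r → 0 ≤ H.eval y) :
    ∀ y ∈ Set.Icc a b, 0 ≤ H.eval y := by
  have hcl : IsClosed {y : ℝ | 0 ≤ H.eval y} := isClosed_le continuous_const H.continuous
  have h1 : Set.Ioo a b ∩ {r}ᶜ ⊆ {y : ℝ | 0 ≤ H.eval y} := fun y hy => h y hy.1 hy.2
  have h2 : Set.Ioo a b ⊆ {y : ℝ | 0 ≤ H.eval y} :=
    ((dense_compl_singleton r).open_subset_closure_inter isOpen_Ioo).trans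
      (closure_minimal h1 hcl)
  have h3 := closure_minimal h2 hcl
  rw [closure_Ioo hab.ne] at h3
  exact h3

lemma QRep.main (L : ℕ) : ∀ G : ℝ[X], G.natDegree ≤ L →
    (∀ y ∈ Set.Icc (0 : ℝ) 1, 0 ≤ G.eval y) → QRep L G := by
  induction L using Nat.strong_induction_on with
  | _ L ih =>
  intro G hdeg hpos
  rcases Nat.eq_zero_or_pos L with rfl | hL
  · rw [eq_C_of_natDegree_le_zero hdeg] at hpos ⊢
    refine QRep.const ?_
    simpa using hpos 0 (by simp)
  rcases Nat.lt_or_ge G.natDegree L with hlt | hge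
  · have := QRep.one_one.mul (ih (L - 1) (by omega) G (by omega) hpos)
    rwa [one_mul, show 1 + (L - 1) = L by omega] at this
  have hGd : G.natDegree = L := le_antisymm hdeg hge
  have hG0 : G ≠ 0 := by rintro rfl; simp at hGd; omega
  -- linear step
  have lin : ∀ (q H : ℝ[X]) (r : ℝ), G = q * H → q.natDegree = 1 → QRep 1 q →
      (∀ y ∈ Set.Ioo (0 : ℝ) 1, y ≠ r → 0 < q.eval y) → QRep L G := by
    intro q H r hGq hq hrep hqpos
    have hH0 : H ≠ 0 := by rintro rfl; simp at hGq; exact hG0 hGq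
    have hq0 : q ≠ 0 := by rintro rfl; simp at hq
    have hd : G.natDegree = q.natDegree + H.natDegree := by rw [hGq, natDegree_mul hq0 hH0]
    have := hrep.mul (ih (L - 1) (by omega) H (by omega) (nonneg_of_off r 0 1 one_pos ?_))
    · rwa [← hGq, show 1 + (L - 1) = L by omega] at this
    · intro y hy hyr
      have h1 := hpos y ⟨hy.1.le, hy.2.le⟩
      rw [hGq, eval_mul] at h1
      exact nonneg_of_mul_nonneg_right h1 (hqpos y hy hyr)
  have quad : ∀ (u v : ℝ) (H : ℝ[X]), G = ((X - C u) ^ 2 + C (v ^ 2)) * H → QRep L G := by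
    intro u v H hGq
    have hq : ((X - C u) ^ 2 + C (v ^ 2)).natDegree = 2 := by
      rw [natDegree_add_C, natDegree_pow, natDegree_X_sub_C]
    have hH0 : H ≠ 0 := by rintro rfl; simp at hGq; exact hG0 hGq
    have hq0 : ((X - C u) ^ 2 + C (v ^ 2)) ≠ 0 := by intro h; rw [h] at hq; simp at hq
    have hd : G.natDegree = 2 + H.natDegree := by rw [hGq, natDegree_mul hq0 hH0, hq]
    have := (QRep.quad u v).mul (ih (L - 2) (by omega) H (by omega) (nonneg_of_off u 0 1 one_pos ?_))
    · rwa [← hGq, show 2 + (L - 2) = L by omega] at this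
    · intro y hy hyr
      have h1 := hpos y ⟨hy.1.le, hy.2.le⟩
      rw [hGq, eval_mul] at h1
      refine nonneg_of_mul_nonneg_right h1 ?_
      have : y - u ≠ 0 := sub_ne_zero.2 hyr
      simp only [eval_add, eval_pow, eval_sub, eval_X, eval_C]
      positivity
  obtain ⟨z, hz⟩ : ∃ z : ℂ, aeval z G = 0 := by
    refine IsAlgClosed.exists_aeval_eq_zero ℂ G ?_
    intro h
    rw [degree_eq_natDegree hG0, hGd] at h
    norm_cast at h
    omega
  by_cases him : z.im = 0
  · have hr : G.IsRoot z.re := by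
      have : z = ((z.re : ℝ) : ℂ) := by apply Complex.ext <;> simp [him]
      rw [this] at hz
      have h2 := aeval_algebraMap_apply ℂ z.re G
      simp only [Complex.coe_algebraMap] at h2
      rw [h2] at hz
      simpa using hz
    generalize z.re = r at hr
    obtain ⟨H, hH⟩ := dvd_iff_isRoot.2 hr
    rcases le_or_gt r 0 with h0 | h0
    · refine lin _ H r hH (natDegree_X_sub_C r) ?_ ?_
      · have := @QRep.linear (-r) 1 (by linarith) (by linarith)
        convert this using 1
        simp; ring
      · intro y hy _
        simp; linarith [hy.1]
    rcases le_or_gt 1 r with h1 | h1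
    · refine lin (-(X - C r)) (-H) r (by rw [hH]; ring) (by rw [natDegree_neg, natDegree_X_sub_C]) ?_ ?_
      · have := @QRep.linear r (-1) (by linarith) (by linarith)
        convert this using 1
        simp; ring
      · intro y hy _
        simp; linarith [hy.2]
    · have hpos' : ∀ y ∈ Set.Icc (0 : ℝ) 1, 0 ≤ (y - r) * H.eval y := by
        intro y hy
        have := hpos y hy
        rw [hH] at this
        simpa using this
      have ha : 0 ≤ H.eval r := by
        refine nonneg_of_off (H := H) r r 1 h1 ?_ r ⟨le_rfl, h1.le⟩
        intro y hy _
        exact nonneg_of_mul_nonneg_right (hpos' y ⟨(h0.trans hy.1).le, hy.2.le⟩) (sub_pos.2 hy.1)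
      have hb : 0 ≤ (-H).eval r := by
        refine nonneg_of_off (H := -H) r 0 r h0 ?_ r ⟨h0.le, le_rfl⟩
        intro y hy _
        have h3 := hpos' y ⟨hy.1.le, (hy.2.trans h1).le⟩
        rw [eval_neg]
        refine nonneg_of_mul_nonneg_right (a := r - y) ?_ (sub_pos.2 hy.2)
        linarith
      have hc : H.IsRoot r := by
        rw [eval_neg] at hb
        exact le_antisymm (by linarith) ha
      obtain ⟨K, hK⟩ := dvd_iff_isRoot.2 hc
      refine quad r 0 K ?_
      rw [hH, hK]; simp; ring
  · obtain ⟨H, hH⟩ := quadratic_dvd_of_aeval_eq_zero_im_ne_zero G hz him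
    refine quad z.re z.im H ?_
    rw [hH]
    congr 1
    have : ‖z‖ ^ 2 = z.re ^ 2 + z.im ^ 2 := by
      rw [← Complex.normSq_eq_norm_sq, Complex.normSq_apply]; ring
    rw [this, two_mul]
    simp only [map_add, map_pow]
    ring

end Rep
section QSP
open Polynomial

lemma Upqc_snoc (L : ℕ) (θ : Fin (L + 1) → ℝ) (φ : ℝ) (x : ℝ) :
    Upqc (L + 1) (Fin.snoc θ φ : Fin (L + 2) → ℝ) x = Upqc L θ x * (Sgate x * RZgate φ) := by
  unfold Upqc
  rw [List.ofFn_succ', List.concat_eq_append, List.prod_append, ← mul_assoc]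
  have h0 : (Fin.snoc θ φ : Fin (L + 2) → ℝ) 0 = θ 0 := by
    exact Fin.snoc_castSucc (α := fun _ => ℝ) φ θ 0
  have h1 : ∀ j : Fin L, (Fin.snoc θ φ : Fin (L + 2) → ℝ) j.castSucc.succ = θ j.succ := by
    intro j
    rw [Fin.succ_castSucc]
    exact Fin.snoc_castSucc (α := fun _ => ℝ) φ θ j.succ
  have h2 : (Fin.snoc θ φ : Fin (L + 2) → ℝ) (Fin.last L).succ = φ := by
    rw [Fin.succ_last]
    exact Fin.snoc_last (α := fun _ => ℝ) φ θ
  simp only [h0, h1, h2, List.prod_singleton]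

/-- conjugate polynomial -/
noncomputable abbrev cj (P : ℂ[X]) : ℂ[X] := P.map (starRingEnd ℂ)

lemma exists_phase (z : ℂ) (hz : ‖z‖ = 1) : ∃ θ : ℝ, z = Complex.exp (-Complex.I * θ / 2) := by
  refine ⟨-2 * Complex.arg z, ?_⟩
  have := Complex.norm_mul_exp_arg_mul_I z
  rw [hz] at this
  conv_lhs => rw [← this]
  rw [Complex.ofReal_one, one_mul]
  congr 1
  push_cast
  ring

lemma cj_eval (P : ℂ[X]) (x : ℝ) : (cj P).eval (x : ℂ) = starRingEnd ℂ (P.eval (x : ℂ)) := by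
  conv_lhs => rw [← Complex.conj_ofReal x]
  rw [eval_map_apply]

lemma exp_phase_conj (φ : ℝ) : starRingEnd ℂ (Complex.exp (-Complex.I * φ / 2)) = Complex.exp (Complex.I * φ / 2) := by
  rw [← Complex.exp_conj]
  simp [map_ofNat]

lemma qsp_complete (L : ℕ) : ∀ P Q : ℂ[X], QHom L P → QHom L (X * Q) →
    P * cj P + (1 - X ^ 2) * (Q * cj Q) = 1 →
    ∃ θ : Fin (L + 1) → ℝ, ∀ x ∈ Set.Icc (-1 : ℝ) 1, Upqc L θ x =
      !![P.eval (x : ℂ), Complex.I * Real.sqrt (1 - x ^ 2) * Q.eval (x : ℂ);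
         Complex.I * Real.sqrt (1 - x ^ 2) * (cj Q).eval (x : ℂ), (cj P).eval (x : ℂ)] := by
  induction L with
  | zero =>
    intro P Q hP hQ h
    have hQ0 : Q = 0 := by
      ext k
      have := hQ (k + 1) (by omega)
      rwa [coeff_X_mul] at this
    have hPc := eq_C_of_natDegree_le_zero hP.natDegree_le
    generalize P.coeff 0 = z at hPc
    subst hPc hQ0
    have hz : ‖z‖ = 1 := by
      have h1 := congrArg (eval 0) h
      simp only [cj, map_C, eval_add, eval_mul, eval_C, Polynomial.map_zero, mul_zero, eval_zero,
        add_zero, eval_one, Complex.mul_conj, Complex.normSq_eq_norm_sq] at h1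
      norm_cast at h1
      exact (pow_eq_one_iff_of_nonneg (norm_nonneg z) two_ne_zero).1 h1
    obtain ⟨θ, rfl⟩ := exists_phase z hz
    refine ⟨fun _ => θ, fun x _ => ?_⟩
    simp only [Upqc, RZgate, List.ofFn_zero, List.prod_nil, mul_one, eval_C, map_C, exp_phase_conj, cj]
    simp
  | succ n ih =>
    intro P Q hP hQ h
    have hQn : QHom n Q := hQ.of_X_mul
    have hlead : P.coeff (n + 1) * starRingEnd ℂ (P.coeff (n + 1)) =
        Q.coeff n * starRingEnd ℂ (Q.coeff n) := by
      have h1 : P * cj P = 1 - Q * cj Q + (X * Q) * (X * cj Q) := by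
        linear_combination h
      have h2 := congrArg (fun f => coeff f ((n + 1) + (n + 1))) h1
      have e1 := coeff_mul_add_eq_of_natDegree_le hP.natDegree_le (hP.map (starRingEnd ℂ)).natDegree_le
      have hQ' : QHom (n + 1) (X * cj Q) := (hQn.map _).X_mul
      have e2 := coeff_mul_add_eq_of_natDegree_le hQ.natDegree_le hQ'.natDegree_le
      have e3 := (hQn.mul (hQn.map (starRingEnd ℂ))) ((n + 1) + (n + 1)) (by omega)
      have e4 : (1 : ℂ[X]).coeff ((n + 1) + (n + 1)) = 0 := by
        rw [coeff_one, if_neg (by omega)]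
      simp only [coeff_add, coeff_sub] at h2
      rw [e1, e2, e3, e4] at h2
      simpa using h2
    obtain ⟨φ, hφ⟩ : ∃ φ : ℝ, Complex.exp (Complex.I * φ / 2) * P.coeff (n + 1)
        = Complex.exp (-Complex.I * φ / 2) * Q.coeff n := by
      have hn : ‖P.coeff (n + 1)‖ = ‖Q.coeff n‖ := by
        simp only [Complex.mul_conj, Complex.normSq_eq_norm_sq] at hlead
        norm_cast at hlead
        exact (sq_eq_sq₀ (norm_nonneg _) (norm_nonneg _)).1 hlead
      by_cases h0 : Q.coeff n = 0
      · refine ⟨0, ?_⟩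
        rw [h0, norm_zero, norm_eq_zero] at hn
        rw [h0, hn]; simp
      · obtain ⟨t, ht⟩ := exists_phase (P.coeff (n + 1) / Q.coeff n) (by
          rw [norm_div, hn, div_self (norm_ne_zero_iff.2 h0)])
        rw [div_eq_iff h0] at ht
        refine ⟨t / 2, ?_⟩
        rw [ht, ← mul_assoc, ← Complex.exp_add]
        congr 2
        push_cast; ring
    obtain ⟨e, he⟩ : ∃ e, e = Complex.exp (Complex.I * φ / 2) := ⟨_, rfl⟩
    obtain ⟨d, hd⟩ : ∃ d, d = Complex.exp (-Complex.I * φ / 2) := ⟨_, rfl⟩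
    have hed : e * d = 1 := by
      rw [he, hd, ← Complex.exp_add]; ring_nf; simp
    have hce : starRingEnd ℂ e = d := by rw [he, hd, ← exp_phase_conj, Complex.conj_conj]
    have hcd : starRingEnd ℂ d = e := by rw [← hce, Complex.conj_conj]
    rw [← he, ← hd] at hφ
    have hED : (C e * C d : ℂ[X]) = 1 := by rw [← C_mul, hed, C_1]
    have hXP : QHom (n + 2) (X * P) := hP.X_mul
    have hXXQ : QHom (n + 2) (X * (X * Q)) := hQ.X_mul
    have g1 : QHom n (C e * (X * P) + (C d * Q - C d * (X * (X * Q)))) := by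
      refine (((hXP.C_mul e).add ((hQn.up.C_mul d).sub (hXXQ.C_mul d)))).down ?_
      have h0 := hQn (n + 2) (by omega)
      simp only [coeff_add, coeff_sub, coeff_C_mul, coeff_X_mul, h0]
      rw [hφ]; ring
    have g2 : QHom n (X * (C d * (X * Q) - C e * P)) := by
      have : X * (C d * (X * Q) - C e * P) = C d * (X * (X * Q)) - C e * (X * P) := by ring
      rw [this]
      refine ((hXXQ.C_mul d).sub (hXP.C_mul e)).down ?_
      simp only [coeff_sub, coeff_C_mul, coeff_X_mul]
      rw [hφ]; ring
    have g3 : (C e * (X * P) + (C d * Q - C d * (X * (X * Q)))) * cj (C e * (X * P) + (C d * Q - C d * (X * (X * Q)))) + (1 - X ^ 2) *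
        ((C d * (X * Q) - C e * P) * cj (C d * (X * Q) - C e * P)) = 1 := by
      simp only [cj, Polynomial.map_add, Polynomial.map_sub, Polynomial.map_mul, map_C, map_X, hce, hcd]
      simp only [cj] at h
      linear_combination h + (P * Polynomial.map (starRingEnd ℂ) P +
        (1 - X ^ 2) * (Q * Polynomial.map (starRingEnd ℂ) Q)) * hED
    obtain ⟨θ, hθ⟩ := ih (C e * (X * P) + (C d * Q - C d * (X * (X * Q))))
      (C d * (X * Q) - C e * P) g1 g2 g3
    refine ⟨Fin.snoc θ φ, fun x hx => ?_⟩
    rw [Upqc_snoc, hθ x hx]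
    have hs : (Real.sqrt (1 - x ^ 2) : ℂ) ^ 2 = 1 - (x : ℂ) ^ 2 := by
      have : Real.sqrt (1 - x ^ 2) ^ 2 = 1 - x ^ 2 :=
        Real.sq_sqrt (by nlinarith [hx.1, hx.2])
      exact_mod_cast congrArg (fun t : ℝ => (t : ℂ)) this
    obtain ⟨s, hsd⟩ : ∃ s : ℂ, (Real.sqrt (1 - x ^ 2) : ℂ) = s := ⟨_, rfl⟩
    rw [hsd] at hs ⊢
    have hS : Sgate x = !![(x : ℂ), Complex.I * s; Complex.I * s, (x : ℂ)] := by
      rw [Sgate, hsd]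
    have hR : RZgate φ = !![d, 0; 0, e] := by rw [RZgate, he, hd]
    rw [hS, hR]
    have hI := Complex.I_sq
    simp only [cj, Polynomial.map_add, Polynomial.map_sub, Polynomial.map_mul, map_C, map_X,
      hce, hcd, eval_add, eval_sub, eval_mul, eval_C, eval_X]
    generalize eval (x : ℂ) (Polynomial.map (starRingEnd ℂ) P) = P'
    generalize eval (x : ℂ) (Polynomial.map (starRingEnd ℂ) Q) = Q'
    generalize eval (x : ℂ) P = P0
    generalize eval (x : ℂ) Q = Q0
    ext i j
    fin_cases i <;> fin_cases j <;>
      simp only [Matrix.mul_apply, Fin.sum_univ_two] <;> simp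
    · linear_combination (s ^ 2 * (d * (x * Q0) - e * P0) * d) * hI
        - ((d * (x * Q0) - e * P0) * d) * hs + P0 * hed
    · linear_combination Complex.I * s * Q0 * hed
    · linear_combination Complex.I * s * Q' * hed
    · linear_combination (s ^ 2 * (e * (x * Q') - d * P') * e) * hI
        - ((e * (x * Q') - d * P') * e) * hs + P' * hed

end QSP

/-- Achievability direction of quantum signal processing for real polynomials: any real
polynomial `p` with `deg p ≤ L`, parity `L mod 2` and `|p| ≤ 1` on `[−1,1]` is realized
as `⟨+|U_θ(x)|+⟩` for some `θ ∈ ℝ^{L+1}`. -/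
theorem qsp_achievability (L : ℕ) (p : Polynomial ℝ)
    (hdeg : p.natDegree ≤ L)
    (hpar : ∀ k, k % 2 ≠ L % 2 → p.coeff k = 0)
    (hbd : ∀ x ∈ Set.Icc (-1 : ℝ) 1, |p.eval x| ≤ 1) :
    ∃ θ : Fin (L + 1) → ℝ, ∀ x ∈ Set.Icc (-1 : ℝ) 1,
      plusForm (Upqc L θ x) = ((p.eval x : ℝ) : ℂ) := by
  have hp : QHom L p := by
    intro k hk
    rcases hk with hk | hk
    · exact Polynomial.coeff_eq_zero_of_natDegree_lt (by omega)
    · exact hpar k hk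
  have hp2 : QHom (L + L) (1 - p * p) := by
    refine QHom.sub ?_ (hp.mul hp)
    intro k hk
    rw [Polynomial.coeff_one, if_neg (by omega)]
  obtain ⟨G, hG⟩ : ∃ G : Polynomial ℝ, Polynomial.expand ℝ 2 G = 1 - p * p := by
    refine ⟨Polynomial.contract 2 (1 - p * p), ?_⟩
    ext k
    rw [Polynomial.coeff_expand two_pos]
    split_ifs with hk
    · rw [Polynomial.coeff_contract two_ne_zero, Nat.div_mul_cancel hk]
    · exact (hp2 k (by omega)).symm
  have hGd : G.natDegree ≤ L := by
    have h1 := hp2.natDegree_le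
    rw [← hG, Polynomial.natDegree_expand] at h1
    omega
  obtain ⟨b, c, hb, hc, h⟩ := QRep.main L G hGd (by
    intro y hy
    have h1 := congrArg (Polynomial.eval (√y)) hG
    rw [Polynomial.expand_eval, Real.sq_sqrt hy.1] at h1
    rw [h1]
    have h2 := abs_le.1 (hbd (√y) ⟨by linarith [Real.sqrt_nonneg y], Real.sqrt_le_one.2 hy.2⟩)
    simp only [Polynomial.eval_sub, Polynomial.eval_mul, Polynomial.eval_one]
    nlinarith)
  rw [hG] at h
  obtain ⟨θ, hθ⟩ := qsp_complete L
    (p.map Complex.ofRealHom + Polynomial.C Complex.I * b.map Complex.ofRealHom)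
    (Polynomial.C Complex.I * c.map Complex.ofRealHom)
    ((hp.map _).add ((hb.map _).C_mul _)) (by
      have := (hc.map Complex.ofRealHom).C_mul Complex.I
      convert this using 1
      simp; ring) (by
      have hr : ∀ f : Polynomial ℝ, (f.map Complex.ofRealHom).map (starRingEnd ℂ)
          = f.map Complex.ofRealHom := by
        intro f; ext k; simp
      have hI : (Polynomial.C Complex.I : Polynomial ℂ) ^ 2 = -1 := by
        rw [← Polynomial.C_pow, Complex.I_sq]; simp
      have h' := congrArg (Polynomial.map Complex.ofRealHom) h
      simp only [Polynomial.map_sub, Polynomial.map_one, Polynomial.map_mul, Polynomial.map_add,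
        Polynomial.map_pow, Polynomial.map_X] at h'
      simp only [cj, Polynomial.map_add, Polynomial.map_mul, hr, Polynomial.map_C, Complex.conj_I,
        Polynomial.C_neg]
      generalize Polynomial.map Complex.ofRealHom p = p' at *
      generalize Polynomial.map Complex.ofRealHom b = b' at *
      generalize Polynomial.map Complex.ofRealHom c = c' at *
      linear_combination -h' - (b' ^ 2 + (1 - Polynomial.X ^ 2) * c' ^ 2) * hI)
  refine ⟨θ, fun x hx => ?_⟩
  rw [hθ x hx]
  have hr : ∀ f : Polynomial ℝ, (f.map Complex.ofRealHom).eval (x : ℂ) = ((f.eval x : ℝ) : ℂ) := by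
    intro f
    exact Polynomial.eval_map_apply (f := Complex.ofRealHom) x
  simp [plusForm, cj_eval, hr]
  ring
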